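/- Let X and Y be star configurations in ℙ² defined by r and s distinct lines respectively (each family of lines meeting properly), with r ≥ s ≥ 2 and X ∩ Y = ∅. If X ∪ Y is a complete intersection of some type (a,b) — i.e., there exist homogeneous forms F, G ∈ ℂ[x,y,z] of degrees a and b whose common zero locus in ℙ² is exactly X ∪ Y and |X ∪ Y| = a·b — then s = r or s = r−1. -/

import Mathlib

open MvPolynomial

noncomputable section

abbrev P2 : Type := Projectivization ℂ (Fin 3 → ℂ)

/-- A line in `ℙ²`: the zero locus of a nonzero linear form. -/
def IsLine (L : Set P2) : Prop :=
  ∃ a : Fin 3 → ℂ, a ≠ 0 ∧ L = {p : P2 | (∑ i, a i * p.rep i) = 0}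

/-- An irreducible conic in `ℙ²`: the zero locus of an irreducible homogeneous quadratic form. -/
def IsIrredConic (γ : Set P2) : Prop :=
  ∃ q : MvPolynomial (Fin 3) ℂ, q.IsHomogeneous 2 ∧ Irreducible q ∧
    γ = {p : P2 | eval p.rep q = 0}

/-- `L` is tangent to `γ` : their intersection is a single point. -/
def IsTangent (L γ : Set P2) : Prop := ∃ p : P2, L ∩ γ = {p}

/-- The star configuration defined by a family of lines: the set of points lying on at
least two of the lines. -/
def starConfig {r : ℕ} (L : Fin r → Set P2) : Set P2 :=
  {p : P2 | ∃ i j : Fin r, i ≠ j ∧ p ∈ L i ∧ p ∈ L j}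

/-- A family of lines meets properly: they are distinct lines, no three concurrent. -/
def MeetsProperly {r : ℕ} (L : Fin r → Set P2) : Prop :=
  (∀ i, IsLine (L i)) ∧ Function.Injective L ∧
    ∀ (p : P2) (i j k : Fin r), p ∈ L i → p ∈ L j → p ∈ L k → i = j ∨ i = k ∨ j = k

/-- `W` is a complete intersection of type `(a,b)`. -/
def IsCI (W : Set P2) (a b : ℕ) : Prop :=
  ∃ F G : MvPolynomial (Fin 3) ℂ, F ≠ 0 ∧ G ≠ 0 ∧
    F.IsHomogeneous a ∧ G.IsHomogeneous b ∧
    {p : P2 | eval p.rep F = 0 ∧ eval p.rep G = 0} = W ∧ W.ncard = a * b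

/-- The `ℂ`-submodule of polynomials vanishing at every point of `W`. -/
def vanishingSubmodule (W : Set P2) : Submodule ℂ (MvPolynomial (Fin 3) ℂ) where
  carrier := {F : MvPolynomial (Fin 3) ℂ | ∀ p ∈ W, eval p.rep F = 0}
  add_mem' := by
    intro a b ha hb p hp
    simp only [map_add, ha p hp, hb p hp, add_zero]
  zero_mem' := by
    intro p hp
    simp
  smul_mem' := by
    intro c F hF p hp
    simp only [smul_eval, hF p hp, mul_zero]

/-- The degree-`d` graded component of the vanishing ideal of `W`. -/
def idealComp (W : Set P2) (d : ℕ) : Submodule ℂ (MvPolynomial (Fin 3) ℂ) :=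
  homogeneousSubmodule (Fin 3) ℂ d ⊓ vanishingSubmodule W

/-- The Hilbert function of `W ⊆ ℙ²`. -/
def HF (W : Set P2) (d : ℕ) : ℤ :=
  (Module.finrank ℂ ↥(homogeneousSubmodule (Fin 3) ℂ d) : ℤ) -
    (Module.finrank ℂ ↥(idealComp W d) : ℤ)

/-- The h-vector of `W ⊆ ℙ²`. -/
def hvec (W : Set P2) : ℕ → ℤ
  | 0 => HF W 0
  | d + 1 => HF W (d + 1) - HF W d

/-- The (affine cone) ideal of a point of `ℙ²`; its powers cut out fat points. -/
def pointIdeal (p : P2) : Ideal (MvPolynomial (Fin 3) ℂ) := RingHom.ker (eval p.rep)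

/-- The degree-`d` graded component of a homogeneous ideal `I`. -/
def idealCompI (I : Ideal (MvPolynomial (Fin 3) ℂ)) (d : ℕ) :
    Submodule ℂ (MvPolynomial (Fin 3) ℂ) :=
  homogeneousSubmodule (Fin 3) ℂ d ⊓ Submodule.restrictScalars ℂ I

/-- The Hilbert function of `S/I`. -/
def HFI (I : Ideal (MvPolynomial (Fin 3) ℂ)) (d : ℕ) : ℤ :=
  (Module.finrank ℂ ↥(homogeneousSubmodule (Fin 3) ℂ d) : ℤ) -
    (Module.finrank ℂ ↥(idealCompI I d) : ℤ)

/-- The h-vector of `S/I`. -/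
def hvecI (I : Ideal (MvPolynomial (Fin 3) ℂ)) : ℕ → ℤ
  | 0 => HFI I 0
  | d + 1 => HFI I (d + 1) - HFI I d

/-- The Hadamard-product relation: `R = P ⋆ Q`. -/
def hadRel (P Q R : P2) : Prop :=
  ∃ (u v : Fin 3 → ℂ) (hu : u ≠ 0) (hv : v ≠ 0) (huv : (fun i => u i * v i) ≠ 0),
    Projectivization.mk ℂ u hu = P ∧ Projectivization.mk ℂ v hv = Q ∧
      Projectivization.mk ℂ (fun i => u i * v i) huv = R

/-- `Δ₀`: points of `ℙ²` with at most one nonzero coordinate. -/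
def Δ₀ : Set P2 := {p : P2 | ∃ i : Fin 3, ∀ j : Fin 3, j ≠ i → p.rep j = 0}


/-- The linear form with the given coefficient vector. -/
def linForm (α : Fin 3 → ℂ) : MvPolynomial (Fin 3) ℂ := ∑ i, C (α i) * X i

theorem eval_linForm (α v : Fin 3 → ℂ) : eval v (linForm α) = α ⬝ᵥ v := by
  simp [linForm, dotProduct]

theorem linForm_ne_zero {α : Fin 3 → ℂ} (hα : α ≠ 0) : linForm α ≠ 0 := by
  obtain ⟨i, hi⟩ := Function.ne_iff.mp hα
  intro h
  apply hi
  simpa [eval_linForm] using congrArg (eval (Pi.single i 1)) h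

theorem linForm_isHomogeneous (α : Fin 3 → ℂ) : (linForm α).IsHomogeneous 1 :=
  IsHomogeneous.sum _ _ _ fun i _ => isHomogeneous_C_mul_X (α i) i

theorem linForm_irreducible {α : Fin 3 → ℂ} (hα : α ≠ 0) : Irreducible (linForm α) := by
  have hne := linForm_ne_zero hα
  apply irreducible_of_totalDegree_eq_one ((linForm_isHomogeneous α).totalDegree hne)
  intro x hx
  rw [isUnit_iff_ne_zero]
  rintro rfl
  exact hne (MvPolynomial.ext _ _ fun i => by simpa using hx i)

theorem linForm_dvd {α : Fin 3 → ℂ} (hα : α ≠ 0) {F : MvPolynomial (Fin 3) ℂ}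
    (hF : ∀ v, α ⬝ᵥ v = 0 → eval v F = 0) : linForm α ∣ F := by
  have : (Ideal.span {linForm α}).IsPrime :=
    (Ideal.span_singleton_prime (linForm_ne_zero hα)).mpr (linForm_irreducible hα).prime
  rw [← Ideal.mem_span_singleton,
    ← IsPrime.vanishingIdeal_zeroLocus (K := ℂ) (Ideal.span {linForm α})]
  intro v hv
  rw [zeroLocus_span] at hv
  have h := hv (linForm α) rfl
  rw [aeval_eq_eval, eval_linForm] at h
  simpa [aeval_eq_eval] using hF v h

theorem MvPolynomial.IsHomogeneous.eval_smul_vec {F : MvPolynomial (Fin 3) ℂ} {d : ℕ}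
    (hF : F.IsHomogeneous d) (c : ℂ) (v : Fin 3 → ℂ) : eval (c • v) F = c ^ d * eval v F := by
  rw [eval_eq, eval_eq, Finset.mul_sum]
  refine Finset.sum_congr rfl fun m hm => ?_
  have hd : ∑ i, m i = d := by
    rw [← hF (mem_support_iff.mp hm), Finsupp.weight_apply, Finsupp.sum_fintype _ _ (by simp)]
    simp
  simp only [Pi.smul_apply, smul_eq_mul, mul_pow, Finset.prod_mul_distrib]
  rw [Finset.prod_pow_eq_pow_sum, Finset.sum_subset (Finset.subset_univ m.support) (by simp), hd]
  ring

/-- The vectors orthogonal to `α`. -/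
def dotKer (α : Fin 3 → ℂ) : Submodule ℂ (Fin 3 → ℂ) := (dotProductBilin ℂ ℂ α).ker

theorem finrank_dotKer {α : Fin 3 → ℂ} (hα : α ≠ 0) : Module.finrank ℂ (dotKer α) = 2 := by
  have hne : dotProductBilin ℂ ℂ α ≠ 0 := by
    obtain ⟨i, hi⟩ := Function.ne_iff.mp hα
    intro h
    apply hi
    simpa using LinearMap.congr_fun h (Pi.single i 1)
  have := Module.Dual.finrank_ker_add_one_of_ne_zero hne
  simp only [Module.finrank_fintype_fun_eq_card, Fintype.card_fin] at this
  exact Nat.succ_injective this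

theorem exists_mem_dotKer_notMem_span {α : Fin 3 → ℂ} (hα : α ≠ 0) (w : Fin 3 → ℂ) :
    ∃ p, α ⬝ᵥ p = 0 ∧ p ∉ Submodule.span ℂ {w} := by
  by_contra! h
  have h1 : dotKer α ≤ Submodule.span ℂ {w} := h
  have h2 := (Submodule.finrank_mono h1).trans (finrank_span_le_card {w})
  rw [finrank_dotKer hα] at h2
  simp at h2

/-- A form of degree `d` vanishing at all the intersection points of more than `d + 1` properly
meeting lines vanishes on each of these lines. -/
theorem eval_eq_zero_on_line {r d : ℕ} {α : Fin r → Fin 3 → ℂ} {F : MvPolynomial (Fin 3) ℂ}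
    (hF : F.IsHomogeneous d) (hd : d + 1 < r) (hα : ∀ i, α i ≠ 0)
    (hstar : ∀ i j, i ≠ j → ∀ v ≠ 0, α i ⬝ᵥ v = 0 → α j ⬝ᵥ v = 0 → eval v F = 0)
    (hprop : ∀ v ≠ 0, ∀ i j k, α i ⬝ᵥ v = 0 → α j ⬝ᵥ v = 0 → α k ⬝ᵥ v = 0 →
      i = j ∨ i = k ∨ j = k)
    (i : Fin r) (w : Fin 3 → ℂ) (hw : α i ⬝ᵥ w = 0) : eval w F = 0 := by
  suffices H : ∀ w ≠ 0, α i ⬝ᵥ w = 0 → eval w F = 0 by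
    rcases eq_or_ne w 0 with rfl | hw0
    · obtain ⟨p, hp, hp0⟩ := exists_mem_dotKer_notMem_span (hα i) 0
      have := hF.eval_smul_vec 0 p
      rwa [H p (by rintro rfl; simp at hp0) hp, mul_zero, zero_smul] at this
    · exact H w hw0 hw
  clear hw w
  intro w hw0 hw
  by_cases hs : ∃ j, i ≠ j ∧ α j ⬝ᵥ w = 0
  · obtain ⟨j, hij, hj⟩ := hs
    exact hstar i j hij w hw0 hw hj
  push Not at hs
  obtain ⟨q, hq, hqw⟩ := exists_mem_dotKer_notMem_span (hα i) w
  obtain ⟨c, hc⟩ := Infinite.exists_notMem_finset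
    (Finset.univ.image fun j => -(α j ⬝ᵥ q) / (α j ⬝ᵥ w))
  set p := q + c • w with hp
  have hip : α i ⬝ᵥ p = 0 := by simp [hp, hq, hw]
  have hjp : ∀ j, i ≠ j → α j ⬝ᵥ p ≠ 0 := by
    intro j hij h
    apply hc
    simp only [Finset.mem_image, Finset.mem_univ, true_and]
    refine ⟨j, ?_⟩
    rw [div_eq_iff (hs j hij)]
    simp only [hp, dotProduct_add, dotProduct_smul, smul_eq_mul] at h
    linear_combination -h
  have hne : ∀ s : ℂ, w + s • p ≠ 0 := by
    intro s h
    rcases eq_or_ne s 0 with rfl | hs0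
    · simp [hw0] at h
    · apply hqw
      rw [Submodule.mem_span_singleton]
      refine ⟨-s⁻¹ - c, ?_⟩
      have h2 : s⁻¹ • (w + s • (q + c • w)) = 0 := by rw [← hp, h, smul_zero]
      rw [smul_add, smul_smul, inv_mul_cancel₀ hs0] at h2
      linear_combination (norm := module) -h2
  let Q : Polynomial ℂ :=
    aeval (fun k => Polynomial.C (w k) + Polynomial.C (p k) * Polynomial.X) F
  have hQ : ∀ s, Q.eval s = eval (w + s • p) F := by
    intro s
    rw [← Polynomial.coe_aeval_eq_eval, ← AlgHom.comp_apply, comp_aeval, aeval_eq_eval]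
    congr 2
    ext k
    simp only [map_add, map_mul, Polynomial.coe_aeval_eq_eval, Polynomial.eval_C,
      Polynomial.eval_X, Pi.add_apply, Pi.smul_apply, smul_eq_mul, mul_comm]
  let f : {j // i ≠ j} → ℂ := fun j => -(α j ⬝ᵥ w) / (α j ⬝ᵥ p)
  have hf : ∀ j : {j // i ≠ j}, α j ⬝ᵥ (w + f j • p) = 0 := by
    intro j
    have := hjp j j.2
    simp only [dotProduct_add, dotProduct_smul, smul_eq_mul, f]
    field_simp
    ring
  have hi : ∀ s : ℂ, α i ⬝ᵥ (w + s • p) = 0 := fun s => by simp [hw, hip]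
  have hQ0 : Q = 0 := by
    refine Polynomial.eq_zero_of_natDegree_lt_card_of_eval_eq_zero Q (f := f) ?_ ?_ ?_
    · intro j k hjk
      have hk := hf k
      rw [← hjk] at hk
      rcases hprop _ (hne (f j)) i j k (hi _) (hf j) hk with h | h | h
      · exact absurd h j.2
      · exact absurd h k.2
      · exact Subtype.ext h
    · intro j
      rw [hQ]
      exact hstar i j j.2 _ (hne _) (hi _) (hf j)
    · have h1 : Q.natDegree ≤ d * 1 :=
        aeval_natDegree_le F hF.totalDegree_le _ fun k => by compute_degree
      have h2 : Fintype.card {j // i ≠ j} = r - 1 := by simp [Fintype.card_subtype_compl]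
      omega
  simpa [hQ0] using (hQ 0).symm

/-- A nonzero form vanishing on `r` distinct lines has degree at least `r`. -/
theorem card_le_degree_of_vanish_on_lines {r d : ℕ} {α : Fin r → Fin 3 → ℂ}
    {F : MvPolynomial (Fin 3) ℂ} (hF : F.IsHomogeneous d) (hF0 : F ≠ 0) (hα : ∀ i, α i ≠ 0)
    (hne : ∀ i j, i ≠ j → ∃ v, α i ⬝ᵥ v = 0 ∧ α j ⬝ᵥ v ≠ 0)
    (hvan : ∀ i v, α i ⬝ᵥ v = 0 → eval v F = 0) : r ≤ d := by
  have hdvd : ∏ i, linForm (α i) ∣ F := by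
    refine Finset.prod_dvd_of_isRelPrime ?_ fun i _ => linForm_dvd (hα i) (hvan i)
    intro i _ j _ hij
    rw [Function.onFun, (linForm_irreducible (hα i)).isRelPrime_iff_not_dvd]
    rintro ⟨H, hH⟩
    obtain ⟨v, hv, hv'⟩ := hne i j hij
    apply hv'
    rw [← eval_linForm, hH, map_mul, eval_linForm, hv, zero_mul]
  have hprod : (∏ i, linForm (α i)).totalDegree = r := by
    rw [(IsHomogeneous.prod Finset.univ _ (fun _ => 1)
      fun i _ => linForm_isHomogeneous (α i)).totalDegree
      (Finset.prod_ne_zero_iff.mpr fun i _ => linForm_ne_zero (hα i))]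
    simp
  obtain ⟨H, rfl⟩ := hdvd
  have h := totalDegree_mul_of_isDomain (left_ne_zero_of_mul hF0) (right_ne_zero_of_mul hF0)
  rw [hF.totalDegree hF0, hprod] at h
  omega

theorem dotKer_eq_of_forall {α β : Fin 3 → ℂ} (hα : α ≠ 0) (hβ : β ≠ 0)
    (h : ∀ v, α ⬝ᵥ v = 0 → β ⬝ᵥ v = 0) : dotKer α = dotKer β :=
  Submodule.eq_of_le_of_finrank_eq h ((finrank_dotKer hα).trans (finrank_dotKer hβ).symm)

theorem MeetsProperly.exists_coeffs {r : ℕ} {L : Fin r → Set P2} (hL : MeetsProperly L) :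
    ∃ α : Fin r → Fin 3 → ℂ, (∀ i, α i ≠ 0) ∧
      (∀ i p, p ∈ L i ↔ α i ⬝ᵥ Projectivization.rep p = 0) ∧
      ∀ i j, dotKer (α i) = dotKer (α j) → i = j := by
  choose α hα hLα using hL.1
  refine ⟨α, hα, fun i p => by rw [hLα i]; rfl, fun i j hij => hL.2.1 ?_⟩
  rw [hLα i, hLα j]
  ext p
  exact Iff.of_eq (congrArg (p.rep ∈ ·) hij)

/-- A nonzero form vanishing on a star configuration of `r` lines has degree at least `r - 1`. -/
theorem MeetsProperly.le_degree_add_one {r d : ℕ} {L : Fin r → Set P2} (hL : MeetsProperly L)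
    {F : MvPolynomial (Fin 3) ℂ} (hF : F.IsHomogeneous d) (hF0 : F ≠ 0)
    (hvan : ∀ p ∈ starConfig L, eval p.rep F = 0) : r ≤ d + 1 := by
  by_contra! hd
  obtain ⟨α, hα, hLα, hinj⟩ := hL.exists_coeffs
  have hmem : ∀ v (hv : v ≠ 0) i, α i ⬝ᵥ v = 0 → Projectivization.mk ℂ v hv ∈ L i := by
    intro v hv i h
    obtain ⟨c, hc⟩ := Projectivization.exists_smul_eq_mk_rep ℂ v hv
    rw [hLα, ← hc, Units.smul_def, dotProduct_smul, h, smul_zero]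
  have hline := eval_eq_zero_on_line hF hd hα
    (fun i j hij v hv hi hj => by
      obtain ⟨c, hc⟩ := Projectivization.exists_smul_eq_mk_rep ℂ v hv
      have h := hvan _ ⟨i, j, hij, hmem v hv i hi, hmem v hv j hj⟩
      rw [← hc, Units.smul_def, hF.eval_smul_vec] at h
      exact (mul_eq_zero.mp h).resolve_left (pow_ne_zero _ c.ne_zero))
    (fun v hv i j k hi hj hk =>
      hL.2.2 _ i j k (hmem v hv i hi) (hmem v hv j hj) (hmem v hv k hk))
  have := card_le_degree_of_vanish_on_lines hF hF0 hα
    (fun i j hij => by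
      by_contra! h
      exact hij (hinj i j (dotKer_eq_of_forall (hα i) (hα j) h))) hline
  omega

theorem MeetsProperly.inter_subsingleton {r : ℕ} {L : Fin r → Set P2} (hL : MeetsProperly L)
    {i j : Fin r} (hij : i ≠ j) : (L i ∩ L j).Subsingleton := by
  obtain ⟨α, hα, hLα, hinj⟩ := hL.exists_coeffs
  rintro p ⟨hpi, hpj⟩ q ⟨hqi, hqj⟩
  rw [hLα] at hpi hpj hqi hqj
  by_contra hpq
  have hind : LinearIndependent ℂ ![p.rep, q.rep] :=
    Projectivization.linearIndependent_pair_iff_ne.mpr hpq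
  have hspan : ∀ k, α k ⬝ᵥ p.rep = 0 → α k ⬝ᵥ q.rep = 0 →
      Submodule.span ℂ (Set.range ![p.rep, q.rep]) = dotKer (α k) := by
    intro k hp hq
    refine Submodule.eq_of_le_of_finrank_eq ?_ ?_
    · rw [Submodule.span_le]
      rintro _ ⟨n, rfl⟩
      fin_cases n
      · exact hp
      · exact hq
    · rw [finrank_span_eq_card hind, finrank_dotKer (hα k), Fintype.card_fin]
  exact hij (hinj i j ((hspan i hpi hqi).symm.trans (hspan j hpj hqj)))

theorem MeetsProperly.ncard_starConfig_le {r : ℕ} {L : Fin r → Set P2} (hL : MeetsProperly L) :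
    (starConfig L).ncard ≤ r.choose 2 := by
  classical
  have hex : ∀ p, ∃ e : Finset (Fin r), p ∈ starConfig L → e.card = 2 ∧ ∀ i ∈ e, p ∈ L i := by
    intro p
    by_cases hp : p ∈ starConfig L
    · obtain ⟨i, j, hij, hi, hj⟩ := hp
      refine ⟨{i, j}, fun _ => ⟨Finset.card_pair hij, ?_⟩⟩
      simp [hi, hj]
    · exact ⟨∅, fun h => absurd h hp⟩
  choose e he using hex
  have h := Set.ncard_le_ncard_of_injOn (s := starConfig L)
    (t := (Finset.powersetCard 2 Finset.univ : Finset (Finset (Fin r)))) e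
    (fun p hp => by simp [(he p hp).1])
    (fun p hp q hq hpq => by
      obtain ⟨i, j, hij, hpe⟩ := Finset.card_eq_two.mp (he p hp).1
      have hqe := hpq.symm.trans hpe
      have h1 := (he p hp).2
      have h2 := (he q hq).2
      rw [hpe] at h1
      rw [hqe] at h2
      exact hL.inter_subsingleton hij ⟨h1 i (by simp), h1 j (by simp)⟩
        ⟨h2 i (by simp), h2 j (by simp)⟩)
  rw [Set.ncard_coe_finset] at h
  simpa using h

/-- **If the union of two disjoint star configurations is a complete intersection, then
`s = r` or `s = r−1`.**
Let `X` and `Y` be star configurations in `ℙ²` defined by `r` and `s` distinct lines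
meeting properly, `r ≥ s ≥ 2`, with `X ∩ Y = ∅`.  If `X ∪ Y` is a complete intersection of
some type `(a,b)`, then `s = r` or `s = r−1`. -/
theorem ci_union_of_stars_forces_sizes
    (r s : ℕ) (hs : 2 ≤ s) (hsr : s ≤ r)
    (ℓ : Fin r → Set P2) (m : Fin s → Set P2)
    (hℓ : MeetsProperly ℓ) (hm : MeetsProperly m)
    (hdisj : starConfig ℓ ∩ starConfig m = ∅)
    (a b : ℕ) (hCI : IsCI (starConfig ℓ ∪ starConfig m) a b) :
    s = r ∨ s = r - 1 := by
  obtain ⟨F, G, hF0, hG0, hF, hG, hW, hcard⟩ := hCI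
  have ha := hℓ.le_degree_add_one hF hF0 fun p hp => (hW.symm.subset (Or.inl hp)).1
  have hb := hℓ.le_degree_add_one hG hG0 fun p hp => (hW.symm.subset (Or.inl hp)).2
  have hle := Set.ncard_union_le (starConfig ℓ) (starConfig m)
  have h1 := hℓ.ncard_starConfig_le
  have h2 := hm.ncard_starConfig_le
  by_contra! hne
  obtain ⟨k, rfl⟩ : ∃ k, r = s + 2 + k := ⟨r - (s + 2), by omega⟩
  have hab : (s + 1 + k) * (s + 1 + k) ≤ a * b := Nat.mul_le_mul (by omega) (by omega)
  have hchoose : ∀ n : ℕ, (n + 1).choose 2 * 2 = (n + 1) * n := fun n => by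
    rw [Nat.choose_two_right, Nat.div_two_mul_two_of_even (Nat.even_mul_pred_self _),
      Nat.add_sub_cancel]
  obtain ⟨t, rfl⟩ : ∃ t, s = t + 1 := ⟨s - 1, by omega⟩
  have e1 := hchoose (t + 1 + 1 + k)
  have e2 := hchoose t
  rw [show t + 1 + 1 + k + 1 = t + 1 + 2 + k by ring] at e1
  nlinarith
end
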